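/- arXiv:2504.03232 — 2 statements merged into one kernel-verified Lean document; each statement's English description precedes it below -/
import Mathlib

section
/- Let 0 < γ, α₁, α₂, β₁, β₂ < 1 satisfy the five conditions: γ+α₁+α₂+β₁+β₂ > 2, γ+α₁+α₂ > 1, γ+β₁+β₂ > 1, γ+α₁+β₁ < 2, and γ+α₂+β₂ < 2. Then there exists a constant C > 0, independent of the times, such that for all t₁, t₂ > 0 with t₁ ≠ t₂, one has ∫₀^{t₁} ∫₀^{t₂} |s₂−s₁|^{−γ} · |t₁−s₁|^{−α₁} · |t₂−s₁|^{−α₂} · |t₁−s₂|^{−β₁} · |t₂−s₂|^{−β₂} ds₂ ds₁ ≤ C · |t₂−t₁|^{2−γ−α₁−α₂−β₁−β₂}. -/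
open MeasureTheory Real

/-- The function equal to `x ^ (-a)` for `x ≤ 1` and to `x ^ (-A)` for `x > 1`. -/
noncomputable def twoPower (a A x : ℝ) : ℝ := if x ≤ 1 then x ^ (-a) else x ^ (-A)

lemma twoPower_self (a x : ℝ) : twoPower a a x = x ^ (-a) := by simp [twoPower]

lemma twoPower_nonneg {a A x : ℝ} (hx : 0 ≤ x) : 0 ≤ twoPower a A x := by
  unfold twoPower; split_ifs <;> positivity

lemma twoPower_mul_twoPower {a A b B x : ℝ} (hx : 0 < x) :
    twoPower a A x * twoPower b B x = twoPower (a + b) (A + B) x := by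
  unfold twoPower; split_ifs <;> rw [← rpow_add hx, neg_add]

lemma twoPower_anti {a A x y : ℝ} (ha : 0 ≤ a) (hA : 0 ≤ A) (hx : 0 < x) (hxy : x ≤ y) :
    twoPower a A y ≤ twoPower a A x := by
  unfold twoPower
  split_ifs with h1 h2 h2
  · exact rpow_le_rpow_of_nonpos hx hxy (by linarith)
  · linarith
  · exact (rpow_le_one_of_one_le_of_nonpos (by linarith) (by linarith)).trans
      (one_le_rpow_of_pos_of_le_one_of_nonpos hx h2 (by linarith))
  · exact rpow_le_rpow_of_nonpos hx hxy (by linarith)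

lemma twoPower_le_three_mul {a A x : ℝ} (ha0 : 0 ≤ a) (ha1 : a ≤ 1) (hx : 1 / 3 ≤ x) :
    twoPower a A x ≤ 3 * twoPower 0 A x := by
  have hx0 : 0 < x := by linarith
  unfold twoPower
  split_ifs with h
  · have h3 : x ^ (-a) ≤ (1 / 3 : ℝ) ^ (-a) :=
      rpow_le_rpow_of_nonpos (by norm_num) hx (by linarith)
    have h4 : (1 / 3 : ℝ) ^ (-a) ≤ (1 / 3 : ℝ) ^ (-1 : ℝ) :=
      rpow_le_rpow_of_exponent_ge (by norm_num) (by norm_num) (by linarith)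
    have h5 : (1 / 3 : ℝ) ^ (-1 : ℝ) = 3 := by rw [rpow_neg_one]; norm_num
    simp only [neg_zero, rpow_zero]
    linarith
  · linarith [rpow_pos_of_pos hx0 (-A)]

lemma twoPower_mul_le {c C b B q p x y : ℝ} (hy : 0 < y) (hyx : y ≤ x)
    (hb : b ≤ q) (hcb : c + b ≤ 2 * q) (hC : p ≤ C) (hCB : 2 * p ≤ C + B) :
    twoPower c C x * twoPower b B y ≤ twoPower q p x * twoPower q p y := by
  have hx : 0 < x := by linarith
  have key : ∀ {s t s' t' : ℝ}, y ^ (t' - t) ≤ x ^ (s - s') →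
      x ^ (-s) * y ^ (-t) ≤ x ^ (-s') * y ^ (-t') := by
    intro s t s' t' h
    have e : x ^ (-s') * y ^ (-t') = x ^ (-s) * y ^ (-t) * (x ^ (s - s') / y ^ (t' - t)) := by
      rw [mul_div_assoc', eq_div_iff (by positivity), mul_assoc, ← rpow_add hy, mul_right_comm,
        ← rpow_add hx]
      ring_nf
    rw [e]
    exact le_mul_of_one_le_right (by positivity) ((one_le_div (by positivity)).2 h)
  unfold twoPower
  split_ifs with h1 h2 h2
  · apply key
    exact (rpow_le_rpow hy.le hyx (by linarith)).trans
      (rpow_le_rpow_of_exponent_ge hx h1 (by linarith))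
  · linarith
  · apply key
    exact (rpow_le_one hy.le h2 (by linarith)).trans
      (one_le_rpow (by linarith) (by linarith))
  · apply key
    rcases le_total B p with h | h
    · exact (rpow_le_rpow hy.le hyx (by linarith)).trans
        (rpow_le_rpow_of_exponent_le (by linarith) (by linarith))
    · exact (rpow_le_one_of_one_le_of_nonpos (by linarith) (by linarith)).trans
        (one_le_rpow (by linarith) (by linarith))

lemma twoPower_mul_mul_le_of_le {a A b B c C q p x y z : ℝ} (hx : 0 < x) (hxy : x ≤ y)
    (hyz : y ≤ z) (hc : 0 ≤ c) (hC : 0 ≤ C) (haq : a ≤ q)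
    (habc : a + b + c ≤ 2 * q) (hBC : p ≤ B + C) (hABC : 2 * p ≤ A + B + C) :
    twoPower a A x * twoPower b B y * twoPower c C z ≤ twoPower q p x * twoPower q p y := by
  have hy : 0 < y := by linarith
  calc twoPower a A x * twoPower b B y * twoPower c C z
      ≤ twoPower a A x * twoPower b B y * twoPower c C y := by
        gcongr
        · exact mul_nonneg (twoPower_nonneg hx.le) (twoPower_nonneg hy.le)
        · exact twoPower_anti hc hC hy hyz
    _ = twoPower (b + c) (B + C) y * twoPower a A x := by
        rw [← twoPower_mul_twoPower hy]; ring
    _ ≤ twoPower q p y * twoPower q p x :=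
        twoPower_mul_le hx hxy haq (by linarith) hBC (by linarith)
    _ = _ := mul_comm _ _

/-- A product of three two-power functions is bounded by pairwise products of a single one: the
largest of the three arguments may be replaced by the middle one. -/
lemma twoPower_mul_mul_le {a A b B c C q p x y z : ℝ} (hx : 0 < x) (hy : 0 < y) (hz : 0 < z)
    (ha : 0 ≤ a) (hb : 0 ≤ b) (hc : 0 ≤ c) (hA : 0 ≤ A) (hB : 0 ≤ B) (hC : 0 ≤ C)
    (haq : a ≤ q) (hbq : b ≤ q) (hcq : c ≤ q) (habc : a + b + c ≤ 2 * q)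
    (hAB : p ≤ A + B) (hAC : p ≤ A + C) (hBC : p ≤ B + C) (hABC : 2 * p ≤ A + B + C) :
    twoPower a A x * twoPower b B y * twoPower c C z ≤
      twoPower q p x * twoPower q p y + twoPower q p x * twoPower q p z +
        twoPower q p y * twoPower q p z := by
  have hX := twoPower_nonneg (a := q) (A := p) hx.le
  have hY := twoPower_nonneg (a := q) (A := p) hy.le
  have hZ := twoPower_nonneg (a := q) (A := p) hz.le
  have hXY := mul_nonneg hX hY
  have hXZ := mul_nonneg hX hZ
  have hYZ := mul_nonneg hY hZ
  rcases le_total x y with h1 | h1 <;> rcases le_total y z with h2 | h2 <;>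
    rcases le_total x z with h3 | h3
  · linarith [twoPower_mul_mul_le_of_le (a := a) (A := A) (b := b) (B := B) (c := c) (C := C)
      (q := q) (p := p) hx h1 h2 hc hC haq (by linarith) (by linarith) (by linarith)]
  · linarith [twoPower_mul_mul_le_of_le (a := a) (A := A) (b := b) (B := B) (c := c) (C := C)
      (q := q) (p := p) hx h1 h2 hc hC haq (by linarith) (by linarith) (by linarith)]
  · linarith [twoPower_mul_mul_le_of_le (a := a) (A := A) (b := c) (B := C) (c := b) (C := B)
      (q := q) (p := p) hx h3 h2 hb hB haq (by linarith) (by linarith) (by linarith)]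
  · linarith [twoPower_mul_mul_le_of_le (a := c) (A := C) (b := a) (B := A) (c := b) (C := B)
      (q := q) (p := p) hz h3 h1 hb hB hcq (by linarith) (by linarith) (by linarith)]
  · linarith [twoPower_mul_mul_le_of_le (a := b) (A := B) (b := a) (B := A) (c := c) (C := C)
      (q := q) (p := p) hy h1 h3 hc hC hbq (by linarith) (by linarith) (by linarith)]
  · linarith [twoPower_mul_mul_le_of_le (a := b) (A := B) (b := c) (B := C) (c := a) (C := A)
      (q := q) (p := p) hy h2 h3 ha hA hbq (by linarith) (by linarith) (by linarith)]
  · linarith [twoPower_mul_mul_le_of_le (a := c) (A := C) (b := b) (B := B) (c := a) (C := A)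
      (q := q) (p := p) hz h2 h1 ha hA hcq (by linarith) (by linarith) (by linarith)]
  · linarith [twoPower_mul_mul_le_of_le (a := c) (A := C) (b := b) (B := B) (c := a) (C := A)
      (q := q) (p := p) hz h2 h1 ha hA hcq (by linarith) (by linarith) (by linarith)]

lemma twoPower_mul_mul_le_of_separated {a A b B c C q p x y z : ℝ}
    (hx : 0 < x) (hy : 0 < y) (hz : 0 < z) (hxyz : 1 ≤ x + y + z) (hq1 : q ≤ 1)
    (ha : 0 ≤ a) (hb : 0 ≤ b) (hc : 0 ≤ c) (hA : 0 ≤ A) (hB : 0 ≤ B) (hC : 0 ≤ C)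
    (haq : a ≤ q) (hbq : b ≤ q) (hcq : c ≤ q)
    (hAB : p ≤ A + B) (hAC : p ≤ A + C) (hBC : p ≤ B + C) (hABC : 2 * p ≤ A + B + C) :
    twoPower a A x * twoPower b B y * twoPower c C z ≤
      3 * (twoPower q p x * twoPower q p y + twoPower q p x * twoPower q p z +
        twoPower q p y * twoPower q p z) := by
  have hX := twoPower_nonneg (a := a) (A := A) hx.le
  have hY := twoPower_nonneg (a := b) (A := B) hy.le
  have hZ := twoPower_nonneg (a := c) (A := C) hz.le
  have hmax : 1 / 3 ≤ x ∨ 1 / 3 ≤ y ∨ 1 / 3 ≤ z := by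
    by_contra! h
    linarith [h.1, h.2.1, h.2.2]
  rcases hmax with h | h | h
  · have := twoPower_mul_mul_le (a := 0) (A := A) (b := b) (B := B) (c := c) (C := C)
      (q := q) (p := p) hx hy hz le_rfl hb hc hA hB hC (by linarith) hbq hcq (by linarith)
      hAB hAC hBC hABC
    have h' := mul_le_mul_of_nonneg_right
      (twoPower_le_three_mul (A := A) ha (haq.trans hq1) h) (mul_nonneg hY hZ)
    linarith
  · have := twoPower_mul_mul_le (a := a) (A := A) (b := 0) (B := B) (c := c) (C := C)
      (q := q) (p := p) hx hy hz ha le_rfl hc hA hB hC haq (by linarith) hcq (by linarith)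
      hAB hAC hBC hABC
    have h' := mul_le_mul_of_nonneg_right
      (twoPower_le_three_mul (A := B) hb (hbq.trans hq1) h) (mul_nonneg hX hZ)
    linarith
  · have := twoPower_mul_mul_le (a := a) (A := A) (b := b) (B := B) (c := 0) (C := C)
      (q := q) (p := p) hx hy hz ha hb le_rfl hA hB hC haq hbq (by linarith) (by linarith)
      hAB hAC hBC hABC
    have h' := mul_le_mul_of_nonneg_right
      (twoPower_le_three_mul (A := C) hc (hcq.trans hq1) h) (mul_nonneg hX hY)
    linarith

lemma rpow_mul_rpow_le_twoPower_of_le {a b x y : ℝ} (hx : 0 < x) (hxy : x ≤ y)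
    (h : 1 ≤ x + y) (hb0 : 0 ≤ b) (hb1 : b ≤ 1) :
    x ^ (-a) * y ^ (-b) ≤ 2 * twoPower a (a + b) x := by
  unfold twoPower
  split_ifs with h1
  · have h3 : y ^ (-b) ≤ (1 / 2 : ℝ) ^ (-b) :=
      rpow_le_rpow_of_nonpos (by norm_num) (by linarith) (by linarith)
    have h4 : (1 / 2 : ℝ) ^ (-b) ≤ (1 / 2 : ℝ) ^ (-1 : ℝ) :=
      rpow_le_rpow_of_exponent_ge (by norm_num) (by norm_num) (by linarith)
    have h5 : (1 / 2 : ℝ) ^ (-1 : ℝ) = 2 := by rw [rpow_neg_one]; norm_num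
    rw [mul_comm 2]
    gcongr
    linarith
  · rw [neg_add, rpow_add hx]
    have h3 : y ^ (-b) ≤ x ^ (-b) := rpow_le_rpow_of_nonpos hx hxy (by linarith)
    have := mul_le_mul_of_nonneg_left h3 (rpow_nonneg hx.le (-a))
    have := mul_nonneg (rpow_nonneg hx.le (-a)) (rpow_nonneg hx.le (-b))
    linarith

lemma rpow_mul_rpow_le_twoPower {a b x y : ℝ} (hx : 0 < x) (hy : 0 < y)
    (h : 1 ≤ x + y) (ha0 : 0 ≤ a) (ha1 : a ≤ 1) (hb0 : 0 ≤ b) (hb1 : b ≤ 1) :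
    x ^ (-a) * y ^ (-b) ≤ 2 * (twoPower a (a + b) x + twoPower b (a + b) y) := by
  have hX := twoPower_nonneg (a := a) (A := a + b) hx.le
  have hY := twoPower_nonneg (a := b) (A := a + b) hy.le
  rcases le_total x y with hxy | hxy
  · linarith [rpow_mul_rpow_le_twoPower_of_le (a := a) hx hxy h hb0 hb1]
  · have := rpow_mul_rpow_le_twoPower_of_le (a := b) hy hxy (by linarith) ha0 ha1
    rw [add_comm b a] at this
    linarith [mul_comm (x ^ (-a)) (y ^ (-b))]

lemma five_rpow_mul_le {γ α₁ α₂ β₁ β₂ q p x₁ x₂ y₁ y₂ z : ℝ}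
    (hx₁ : 0 < x₁) (hx₂ : 0 < x₂) (hy₁ : 0 < y₁) (hy₂ : 0 < y₂) (hz : 0 < z)
    (hx : 1 ≤ x₁ + x₂) (hy : 1 ≤ y₁ + y₂) (h₁₂ : 1 ≤ x₁ + y₂ + z) (h₂₁ : 1 ≤ x₂ + y₁ + z)
    (hγ : 0 ≤ γ) (hα₁ : 0 ≤ α₁) (hα₂ : 0 ≤ α₂) (hβ₁ : 0 ≤ β₁) (hβ₂ : 0 ≤ β₂) (hq : q ≤ 1)
    (hγq : γ ≤ q) (hα₁q : α₁ ≤ q) (hα₂q : α₂ ≤ q) (hβ₁q : β₁ ≤ q) (hβ₂q : β₂ ≤ q)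
    (hq₁ : γ + α₁ + β₁ ≤ 2 * q) (hq₂ : γ + α₂ + β₂ ≤ 2 * q)
    (hp₁ : p ≤ γ + α₁ + α₂) (hp₂ : p ≤ γ + β₁ + β₂) (hp₃ : p ≤ α₁ + α₂ + β₁ + β₂)
    (hp : 2 * p ≤ γ + α₁ + α₂ + β₁ + β₂) :
    z ^ (-γ) * x₁ ^ (-α₁) * x₂ ^ (-α₂) * y₁ ^ (-β₁) * y₂ ^ (-β₂) ≤
      12 * ((twoPower q p x₁ * twoPower q p y₁ + twoPower q p x₁ * twoPower q p z +
          twoPower q p y₁ * twoPower q p z) +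
        (twoPower q p x₁ * twoPower q p y₂ + twoPower q p x₁ * twoPower q p z +
          twoPower q p y₂ * twoPower q p z) +
        (twoPower q p x₂ * twoPower q p y₁ + twoPower q p x₂ * twoPower q p z +
          twoPower q p y₁ * twoPower q p z) +
        (twoPower q p x₂ * twoPower q p y₂ + twoPower q p x₂ * twoPower q p z +
          twoPower q p y₂ * twoPower q p z)) := by
  have hX₁ := twoPower_nonneg (a := q) (A := p) hx₁.le
  have hX₂ := twoPower_nonneg (a := q) (A := p) hx₂.le
  have hY₁ := twoPower_nonneg (a := q) (A := p) hy₁.le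
  have hY₂ := twoPower_nonneg (a := q) (A := p) hy₂.le
  have hZ := twoPower_nonneg (a := q) (A := p) hz.le
  have e₁₁ := twoPower_mul_mul_le (a := α₁) (A := α₁ + α₂) (b := β₁) (B := β₁ + β₂) (c := γ)
    (C := γ) (q := q) (p := p) hx₁ hy₁ hz hα₁ hβ₁ hγ (by linarith) (by linarith) hγ
    hα₁q hβ₁q hγq (by linarith) (by linarith) (by linarith) (by linarith) (by linarith)
  have e₂₂ := twoPower_mul_mul_le (a := α₂) (A := α₁ + α₂) (b := β₂) (B := β₁ + β₂) (c := γ)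
    (C := γ) (q := q) (p := p) hx₂ hy₂ hz hα₂ hβ₂ hγ (by linarith) (by linarith) hγ
    hα₂q hβ₂q hγq (by linarith) (by linarith) (by linarith) (by linarith) (by linarith)
  have e₁₂ := twoPower_mul_mul_le_of_separated (a := α₁) (A := α₁ + α₂) (b := β₂)
    (B := β₁ + β₂) (c := γ) (C := γ) (q := q) (p := p) hx₁ hy₂ hz h₁₂ hq hα₁ hβ₂ hγ
    (by linarith) (by linarith) hγ
    hα₁q hβ₂q hγq (by linarith) (by linarith) (by linarith) (by linarith)
  have e₂₁ := twoPower_mul_mul_le_of_separated (a := α₂) (A := α₁ + α₂) (b := β₁)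
    (B := β₁ + β₂) (c := γ) (C := γ) (q := q) (p := p) hx₂ hy₁ hz h₂₁ hq hα₂ hβ₁ hγ
    (by linarith) (by linarith) hγ
    hα₂q hβ₁q hγq (by linarith) (by linarith) (by linarith) (by linarith)
  rw [twoPower_self] at e₁₁ e₁₂ e₂₁ e₂₂
  have hα := rpow_mul_rpow_le_twoPower hx₁ hx₂ hx hα₁ (hα₁q.trans hq) hα₂ (hα₂q.trans hq)
  have hβ := rpow_mul_rpow_le_twoPower hy₁ hy₂ hy hβ₁ (hβ₁q.trans hq) hβ₂ (hβ₂q.trans hq)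
  have hz' : 0 ≤ z ^ (-γ) := by positivity
  have hαβ := mul_le_mul_of_nonneg_right
    (mul_le_mul hα hβ (by positivity) (le_trans (by positivity) hα)) hz'
  have n₁ := mul_nonneg hX₁ hY₁
  have n₂ := mul_nonneg hX₂ hY₂
  have n₃ := mul_nonneg hX₁ hZ
  have n₄ := mul_nonneg hX₂ hZ
  have n₅ := mul_nonneg hY₁ hZ
  have n₆ := mul_nonneg hY₂ hZ
  calc _ = x₁ ^ (-α₁) * x₂ ^ (-α₂) * (y₁ ^ (-β₁) * y₂ ^ (-β₂)) * z ^ (-γ) := by ring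
    _ ≤ _ := hαβ
    _ ≤ _ := by linarith

lemma measurable_twoPower (a A : ℝ) : Measurable (twoPower a A) :=
  Measurable.ite measurableSet_Iic (by fun_prop) (by fun_prop)

lemma integrable_twoPower_abs {q p : ℝ} (hq : q < 1) (hp : 1 < p) :
    Integrable fun x : ℝ => twoPower q p |x| := by
  have h1 : IntegrableOn (twoPower q p) (Set.Ioi 0) := by
    rw [← Set.Ioc_union_Ioi_eq_Ioi zero_le_one]
    refine IntegrableOn.union ?_ ?_
    · refine IntegrableOn.congr_fun (f := fun x => x ^ (-q)) ?_ (fun x hx => ?_) measurableSet_Ioc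
      · rw [integrableOn_Ioc_iff_integrableOn_Ioo]
        exact (intervalIntegral.integrableOn_Ioo_rpow_iff zero_lt_one).2 (by linarith)
      · exact (if_pos hx.2).symm
    · refine IntegrableOn.congr_fun (f := fun x => x ^ (-p))
        (integrableOn_Ioi_rpow_of_lt (by linarith) zero_lt_one) (fun x hx => ?_) measurableSet_Ioi
      exact (if_neg (not_le.2 hx)).symm
  simpa using (integrable_fun_norm_addHaar (volume : Measure ℝ) (f := twoPower q p)).2 (by simpa)

lemma lintegral_comp_div (f : ℝ → ENNReal) (hf : Measurable f) {D : ℝ} (hD : 0 < D) :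
    ∫⁻ x, f (x / D) = ENNReal.ofReal D * ∫⁻ x, f x := by
  have h := Real.map_volume_mul_right (inv_ne_zero hD.ne')
  rw [← lintegral_map hf (by fun_prop : Measurable fun x : ℝ => x / D)]
  simp_rw [div_eq_mul_inv]
  rw [h, lintegral_smul_measure, inv_inv, abs_of_pos hD, smul_eq_mul]

lemma lintegral_lintegral_three_products {K : ℝ → ENNReal} (hK : Measurable K) (t t' : ℝ) :
    ∫⁻ x, ∫⁻ y, (K (t - x) * K (t' - y) + K (t - x) * K (y - x) + K (t' - y) * K (y - x)) =
      3 * (∫⁻ x, K x) ^ 2 := by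
  have hy : ∀ x, ∫⁻ y, K (y - x) = ∫⁻ x, K x := fun x => lintegral_sub_right_eq_self K x
  have hx : ∀ t, ∫⁻ x, K (t - x) = ∫⁻ x, K x := fun t => lintegral_sub_left_eq_self K t
  have e₁ : ∫⁻ x, ∫⁻ y, K (t - x) * K (t' - y) = (∫⁻ x, K x) ^ 2 := by
    simp_rw [lintegral_const_mul _ (show Measurable fun y => K (t' - y) by fun_prop), hx]
    rw [lintegral_mul_const _ (by fun_prop), hx, sq]
  have e₂ : ∫⁻ x, ∫⁻ y, K (t - x) * K (y - x) = (∫⁻ x, K x) ^ 2 := by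
    rw [lintegral_congr fun x => lintegral_const_mul (K (t - x)) (by fun_prop)]
    simp_rw [hy]
    rw [lintegral_mul_const _ (by fun_prop), hx, sq]
  have e₃ : ∫⁻ x, ∫⁻ y, K (t' - y) * K (y - x) = (∫⁻ x, K x) ^ 2 := by
    rw [lintegral_lintegral_swap (by fun_prop)]
    rw [lintegral_congr fun y => lintegral_const_mul (K (t' - y)) (by fun_prop)]
    simp_rw [hx]
    rw [lintegral_mul_const _ (by fun_prop), hx, sq]
  have : ∀ x, ∫⁻ y, (K (t - x) * K (t' - y) + K (t - x) * K (y - x) + K (t' - y) * K (y - x)) =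
      (∫⁻ y, K (t - x) * K (t' - y)) + (∫⁻ y, K (t - x) * K (y - x)) +
        ∫⁻ y, K (t' - y) * K (y - x) := fun x => by
    rw [lintegral_add_left (by fun_prop), lintegral_add_left (by fun_prop)]
  simp_rw [this]
  rw [lintegral_add_left (by fun_prop), lintegral_add_left (by fun_prop), e₁, e₂, e₃]
  ring

lemma five_rpow_mul_le_scaled {γ α₁ α₂ β₁ β₂ q p t₁ t₂ : ℝ} (ht : t₁ ≠ t₂)
    (hγ : 0 < γ) (hα₁ : 0 < α₁) (hα₂ : 0 < α₂) (hβ₁ : 0 < β₁) (hβ₂ : 0 < β₂) (hq : q ≤ 1)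
    (hγq : γ ≤ q) (hα₁q : α₁ ≤ q) (hα₂q : α₂ ≤ q) (hβ₁q : β₁ ≤ q) (hβ₂q : β₂ ≤ q)
    (hq₁ : γ + α₁ + β₁ ≤ 2 * q) (hq₂ : γ + α₂ + β₂ ≤ 2 * q)
    (hp₁ : p ≤ γ + α₁ + α₂) (hp₂ : p ≤ γ + β₁ + β₂) (hp₃ : p ≤ α₁ + α₂ + β₁ + β₂)
    (hp : 2 * p ≤ γ + α₁ + α₂ + β₁ + β₂)
    {K : ℝ → ℝ} (hK : ∀ s, K s = twoPower q p (|s| / |t₂ - t₁|)) (x y : ℝ) :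
    |y - x| ^ (-γ) * |t₁ - x| ^ (-α₁) * |t₂ - x| ^ (-α₂) * |t₁ - y| ^ (-β₁) *
        |t₂ - y| ^ (-β₂) ≤
      12 * |t₂ - t₁| ^ (-(γ + α₁ + α₂ + β₁ + β₂)) *
        ((K (t₁ - x) * K (t₁ - y) + K (t₁ - x) * K (y - x) + K (t₁ - y) * K (y - x)) +
          (K (t₁ - x) * K (t₂ - y) + K (t₁ - x) * K (y - x) + K (t₂ - y) * K (y - x)) +
          (K (t₂ - x) * K (t₁ - y) + K (t₂ - x) * K (y - x) + K (t₁ - y) * K (y - x)) +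
          (K (t₂ - x) * K (t₂ - y) + K (t₂ - x) * K (y - x) + K (t₂ - y) * K (y - x))) := by
  have hD : 0 < |t₂ - t₁| := abs_pos.2 (sub_ne_zero.2 ht.symm)
  have hK0 : ∀ s, 0 ≤ K s := fun s => by rw [hK]; exact twoPower_nonneg (by positivity)
  have hrhs : 0 ≤ 12 * |t₂ - t₁| ^ (-(γ + α₁ + α₂ + β₁ + β₂)) *
        ((K (t₁ - x) * K (t₁ - y) + K (t₁ - x) * K (y - x) + K (t₁ - y) * K (y - x)) +
          (K (t₁ - x) * K (t₂ - y) + K (t₁ - x) * K (y - x) + K (t₂ - y) * K (y - x)) +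
          (K (t₂ - x) * K (t₁ - y) + K (t₂ - x) * K (y - x) + K (t₁ - y) * K (y - x)) +
          (K (t₂ - x) * K (t₂ - y) + K (t₂ - x) * K (y - x) + K (t₂ - y) * K (y - x))) := by
    have h₁ := hK0 (t₁ - x)
    have h₂ := hK0 (t₂ - x)
    have h₃ := hK0 (t₁ - y)
    have h₄ := hK0 (t₂ - y)
    have h₅ := hK0 (y - x)
    positivity
  by_cases hz : y - x = 0
  · simpa [hz, zero_rpow (neg_ne_zero.2 hγ.ne')] using hrhs
  by_cases hx₁ : t₁ - x = 0
  · simpa [hx₁, zero_rpow (neg_ne_zero.2 hα₁.ne')] using hrhs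
  by_cases hx₂ : t₂ - x = 0
  · simpa [hx₂, zero_rpow (neg_ne_zero.2 hα₂.ne')] using hrhs
  by_cases hy₁ : t₁ - y = 0
  · simpa [hy₁, zero_rpow (neg_ne_zero.2 hβ₁.ne')] using hrhs
  by_cases hy₂ : t₂ - y = 0
  · simpa [hy₂, zero_rpow (neg_ne_zero.2 hβ₂.ne')] using hrhs
  clear hrhs
  have hpos : ∀ {s : ℝ}, s ≠ 0 → 0 < |s| / |t₂ - t₁| := fun hs => div_pos (abs_pos.2 hs) hD
  have hx : |t₂ - t₁| ≤ |t₁ - x| + |t₂ - x| := by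
    rw [add_comm, abs_sub_comm t₁ x]; exact abs_sub_le _ _ _
  have hy : |t₂ - t₁| ≤ |t₁ - y| + |t₂ - y| := by
    rw [add_comm, abs_sub_comm t₁ y]; exact abs_sub_le _ _ _
  have h₁₂ : |t₂ - t₁| ≤ |t₁ - x| + |t₂ - y| + |y - x| := by
    linarith [abs_sub_le t₂ y x]
  have h₂₁ : |t₂ - t₁| ≤ |t₂ - x| + |t₁ - y| + |y - x| := by
    linarith [abs_sub_le t₁ y x]
  have key := five_rpow_mul_le (q := q) (p := p) (hpos hx₁) (hpos hx₂) (hpos hy₁) (hpos hy₂)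
    (hpos hz) (by rwa [← add_div, one_le_div hD]) (by rwa [← add_div, one_le_div hD])
    (by rwa [← add_div, ← add_div, one_le_div hD]) (by rwa [← add_div, ← add_div, one_le_div hD])
    hγ.le hα₁.le hα₂.le hβ₁.le hβ₂.le hq hγq hα₁q hα₂q hβ₁q hβ₂q hq₁ hq₂ hp₁ hp₂ hp₃ hp
  simp only [← hK] at key
  simp only [div_rpow (abs_nonneg _) hD.le] at key
  have e : |t₂ - t₁| ^ (-(γ + α₁ + α₂ + β₁ + β₂)) = |t₂ - t₁| ^ (-γ) * |t₂ - t₁| ^ (-α₁) *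
      |t₂ - t₁| ^ (-α₂) * |t₂ - t₁| ^ (-β₁) * |t₂ - t₁| ^ (-β₂) := by
    simp only [← rpow_add hD]
    ring_nf
  have hDpow : 0 < |t₂ - t₁| ^ (-(γ + α₁ + α₂ + β₁ + β₂)) := by positivity
  have := mul_le_mul_of_nonneg_left key hDpow.le
  calc _ = |t₂ - t₁| ^ (-(γ + α₁ + α₂ + β₁ + β₂)) * _ := by
        rw [e, div_mul_div_comm, div_mul_div_comm, div_mul_div_comm, div_mul_div_comm,
          mul_div_cancel₀ _ (by positivity)]
    _ ≤ _ := this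
    _ = _ := by ring

lemma exists_exponents {γ α₁ α₂ β₁ β₂ : ℝ} (hγ1 : γ < 1)
    (hα₁1 : α₁ < 1) (hα₂1 : α₂ < 1) (hβ₁1 : β₁ < 1) (hβ₂1 : β₂ < 1)
    (h1 : 2 < γ + α₁ + α₂ + β₁ + β₂) (h2 : 1 < γ + α₁ + α₂) (h3 : 1 < γ + β₁ + β₂)
    (h4 : γ + α₁ + β₁ < 2) (h5 : γ + α₂ + β₂ < 2) :
    (∃ q < 1, γ ≤ q ∧ α₁ ≤ q ∧ α₂ ≤ q ∧ β₁ ≤ q ∧ β₂ ≤ q ∧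
      γ + α₁ + β₁ ≤ 2 * q ∧ γ + α₂ + β₂ ≤ 2 * q) ∧
    ∃ p > 1, p ≤ γ + α₁ + α₂ ∧ p ≤ γ + β₁ + β₂ ∧ p ≤ α₁ + α₂ + β₁ + β₂ ∧
      2 * p ≤ γ + α₁ + α₂ + β₁ + β₂ := by
  constructor
  · obtain ⟨q, hq, hq1⟩ : ∃ q, max γ (max α₁ (max α₂ (max β₁ (max β₂
        (max ((γ + α₁ + β₁) / 2) ((γ + α₂ + β₂) / 2)))))) < q ∧ q < 1 := by
      refine exists_between ?_
      simp only [max_lt_iff]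
      refine ⟨?_, ?_, ?_, ?_, ?_, ?_, ?_⟩ <;> linarith
    simp only [max_lt_iff] at hq
    obtain ⟨_, _, _, _, _, _, _⟩ := hq
    refine ⟨q, hq1, ?_, ?_, ?_, ?_, ?_, ?_, ?_⟩ <;> linarith
  · obtain ⟨p, hp1, hp⟩ : ∃ p, 1 < p ∧ p < min (γ + α₁ + α₂) (min (γ + β₁ + β₂)
        (min (α₁ + α₂ + β₁ + β₂) ((γ + α₁ + α₂ + β₁ + β₂) / 2))) := by
      refine exists_between ?_
      simp only [lt_min_iff]
      refine ⟨?_, ?_, ?_, ?_⟩ <;> linarith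
    simp only [lt_min_iff] at hp
    obtain ⟨_, _, _, _⟩ := hp
    refine ⟨p, hp1, ?_, ?_, ?_, ?_⟩ <;> linarith

lemma enorm_setIntegral_setIntegral_le (f : ℝ → ℝ → ℝ) (s t : Set ℝ) :
    ‖∫ x in s, ∫ y in t, f x y‖ₑ ≤ ∫⁻ x, ∫⁻ y, ‖f x y‖ₑ :=
  calc _ ≤ ∫⁻ x in s, ‖∫ y in t, f x y‖ₑ := enorm_integral_le_lintegral_enorm _
    _ ≤ ∫⁻ x, ‖∫ y in t, f x y‖ₑ := setLIntegral_le_lintegral _ _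
    _ ≤ _ := lintegral_mono fun _ =>
      (enorm_integral_le_lintegral_enorm _).trans (setLIntegral_le_lintegral _ _)

/-- The sum of four integrals as in `lintegral_lintegral_three_products`, with both centres ranging
over `t₁` and `t₂`. -/
lemma lintegral_lintegral_twelve_products {K : ℝ → ENNReal} (hK : Measurable K) (t₁ t₂ : ℝ) :
    ∫⁻ x, ∫⁻ y,
      ((K (t₁ - x) * K (t₁ - y) + K (t₁ - x) * K (y - x) + K (t₁ - y) * K (y - x)) +
        (K (t₁ - x) * K (t₂ - y) + K (t₁ - x) * K (y - x) + K (t₂ - y) * K (y - x)) +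
        (K (t₂ - x) * K (t₁ - y) + K (t₂ - x) * K (y - x) + K (t₁ - y) * K (y - x)) +
        (K (t₂ - x) * K (t₂ - y) + K (t₂ - x) * K (y - x) + K (t₂ - y) * K (y - x))) =
      12 * (∫⁻ x, K x) ^ 2 := by
  have hm : ∀ t t', Measurable (Function.uncurry fun x y =>
      K (t - x) * K (t' - y) + K (t - x) * K (y - x) + K (t' - y) * K (y - x)) := fun t t' => by
    unfold Function.uncurry
    fun_prop
  have hsplit : ∀ {F G : ℝ → ℝ → ENNReal}, Measurable (Function.uncurry G) →
      ∫⁻ x, ∫⁻ y, (F x y + G x y) = (∫⁻ x, ∫⁻ y, F x y) + ∫⁻ x, ∫⁻ y, G x y := fun {F G} hG => by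
    rw [lintegral_congr fun x => lintegral_add_right (F x) (hG.of_uncurry_left),
      lintegral_add_right _ hG.lintegral_prod_right]
  rw [hsplit (hm t₂ t₂), hsplit (hm t₂ t₁), hsplit (hm t₁ t₂)]
  simp only [lintegral_lintegral_three_products hK]
  ring

/-- a two-dimensional singular-integral estimate over the rectangle
`(0,t₁) × (0,t₂)`. -/
theorem double_singular_integral_bound (γ α₁ α₂ β₁ β₂ : ℝ)
    (hγ0 : 0 < γ) (hγ1 : γ < 1)
    (hα₁0 : 0 < α₁) (hα₁1 : α₁ < 1) (hα₂0 : 0 < α₂) (hα₂1 : α₂ < 1)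
    (hβ₁0 : 0 < β₁) (hβ₁1 : β₁ < 1) (hβ₂0 : 0 < β₂) (hβ₂1 : β₂ < 1)
    (h1 : 2 < γ + α₁ + α₂ + β₁ + β₂)
    (h2 : 1 < γ + α₁ + α₂)
    (h3 : 1 < γ + β₁ + β₂)
    (h4 : γ + α₁ + β₁ < 2)
    (h5 : γ + α₂ + β₂ < 2) :
    ∃ C : ℝ, 0 < C ∧
      ∀ t₁ t₂ : ℝ, 0 < t₁ → 0 < t₂ → t₁ ≠ t₂ →
        (∫ s₁ in Set.Ioo (0 : ℝ) t₁, ∫ s₂ in Set.Ioo (0 : ℝ) t₂,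
            |s₂ - s₁| ^ (-γ) * |t₁ - s₁| ^ (-α₁) * |t₂ - s₁| ^ (-α₂) *
              |t₁ - s₂| ^ (-β₁) * |t₂ - s₂| ^ (-β₂)) ≤
          C * |t₂ - t₁| ^ (2 - γ - α₁ - α₂ - β₁ - β₂) := by
  obtain ⟨⟨q, hq, hγq, hα₁q, hα₂q, hβ₁q, hβ₂q, hq₁, hq₂⟩, p, hp, hp₁, hp₂, hp₃, hp₄⟩ :=
    exists_exponents hγ1 hα₁1 hα₂1 hβ₁1 hβ₂1 h1 h2 h3 h4 h5
  have hfin := (integrable_twoPower_abs hq hp).lintegral_lt_top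
  set I := ∫⁻ x : ℝ, ENNReal.ofReal (twoPower q p |x|) with hI
  refine ⟨144 * I.toReal ^ 2 + 1, by positivity, fun t₁ t₂ _ _ ht => ?_⟩
  have hD : 0 < |t₂ - t₁| := abs_pos.2 (sub_ne_zero.2 ht.symm)
  set D := |t₂ - t₁| with hDdef
  set K : ℝ → ℝ := fun s => twoPower q p (|s| / D)
  have hK0 : ∀ s, 0 ≤ K s := fun s => twoPower_nonneg (by positivity)
  have hmeas : Measurable fun s : ℝ => ENNReal.ofReal (twoPower q p |s|) :=
    ((measurable_twoPower q p).comp measurable_norm).ennreal_ofReal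
  have hKabs : ∀ s, K s = twoPower q p |s / D| := fun s => by rw [abs_div, abs_of_pos hD]
  have hKm : Measurable fun s => ENNReal.ofReal (K s) := by
    simp_rw [hKabs]
    exact hmeas.comp (by fun_prop : Measurable fun s : ℝ => s / D)
  have hKI : ∫⁻ s, ENNReal.ofReal (K s) = ENNReal.ofReal (D * I.toReal) := by
    simp_rw [hKabs]
    rw [lintegral_comp_div _ hmeas hD, ← hI, ENNReal.ofReal_mul hD.le,
      ENNReal.ofReal_toReal hfin.ne]
  set c := 12 * D ^ (-(γ + α₁ + α₂ + β₁ + β₂)) with hc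
  have hc0 : 0 ≤ c := by positivity
  have hbound := enorm_setIntegral_setIntegral_le (fun s₁ s₂ =>
    |s₂ - s₁| ^ (-γ) * |t₁ - s₁| ^ (-α₁) * |t₂ - s₁| ^ (-α₂) *
      |t₁ - s₂| ^ (-β₁) * |t₂ - s₂| ^ (-β₂)) (Set.Ioo 0 t₁) (Set.Ioo 0 t₂)
  have hle := hbound.trans (lintegral_mono fun x => lintegral_mono fun y =>
    le_of_eq_of_le (Real.enorm_of_nonneg (by positivity)) (ENNReal.ofReal_le_ofReal
      (five_rpow_mul_le_scaled ht hγ0 hα₁0 hα₂0 hβ₁0 hβ₂0 hq.le hγq hα₁q hα₂q hβ₁q hβ₂q hq₁ hq₂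
        hp₁ hp₂ hp₃ hp₄ (K := K) (fun _ => rfl) x y)))
  rw [← hDdef, ← hc] at hle
  have hofReal : ∀ a b d : ℝ, 0 ≤ a → 0 ≤ b → 0 ≤ d → ENNReal.ofReal (a * b + a * d + b * d) =
      ENNReal.ofReal a * ENNReal.ofReal b + ENNReal.ofReal a * ENNReal.ofReal d +
        ENNReal.ofReal b * ENNReal.ofReal d := fun a b d ha hb hd => by
    rw [ENNReal.ofReal_add (by positivity) (by positivity),
      ENNReal.ofReal_add (by positivity) (by positivity), ENNReal.ofReal_mul ha,
      ENNReal.ofReal_mul ha, ENNReal.ofReal_mul hb]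
  have hpos : ∀ a b d : ℝ, 0 ≤ K a * K b + K a * K d + K b * K d := fun a b d =>
    add_nonneg (add_nonneg (mul_nonneg (hK0 _) (hK0 _)) (mul_nonneg (hK0 _) (hK0 _)))
      (mul_nonneg (hK0 _) (hK0 _))
  have hsum : ∀ a b d e : ℝ, 0 ≤ a → 0 ≤ b → 0 ≤ d → 0 ≤ e → ENNReal.ofReal (a + b + d + e) =
      ENNReal.ofReal a + ENNReal.ofReal b + ENNReal.ofReal d + ENNReal.ofReal e :=
    fun a b d e ha hb hd he => by
      rw [ENNReal.ofReal_add (by positivity) he, ENNReal.ofReal_add (by positivity) hd,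
        ENNReal.ofReal_add ha hb]
  simp_rw [ENNReal.ofReal_mul hc0, hsum _ _ _ _ (hpos _ _ _) (hpos _ _ _) (hpos _ _ _) (hpos _ _ _),
    hofReal _ _ _ (hK0 _) (hK0 _) (hK0 _), lintegral_const_mul' _ _ ENNReal.ofReal_ne_top] at hle
  rw [lintegral_lintegral_twelve_products hKm, hKI, ← ENNReal.ofReal_pow (by positivity),
    ← ENNReal.ofReal_ofNat 12, ← ENNReal.ofReal_mul (by positivity), ← ENNReal.ofReal_mul hc0,
    Real.enorm_eq_ofReal_abs, ENNReal.ofReal_le_ofReal_iff (by positivity)] at hle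
  have e : D ^ (2 - γ - α₁ - α₂ - β₁ - β₂) = D ^ (-(γ + α₁ + α₂ + β₁ + β₂)) * D ^ 2 := by
    rw [← rpow_natCast, ← rpow_add hD]
    congr 1
    push_cast
    ring
  calc _ ≤ c * (12 * (D * I.toReal) ^ 2) := (le_abs_self _).trans hle
    _ = 144 * I.toReal ^ 2 * D ^ (2 - γ - α₁ - α₂ - β₁ - β₂) := by rw [e, hc]; ring
    _ ≤ _ := by
      gcongr
      linarith
end

section
/- Let T > 0. There exists a constant C = C(T) > 0 such that for all times 0 < s₁ < t₁ ≤ T, 0 < s₂ < t₂ ≤ T, all σ₁, τ₁, τ₂, τ₃ ∈ (0, 2T+2], and all points y₁, y₂, z₁, z₂ ∈ ℝ³, one has ∫_{ℝ³} ∫_{ℝ³} K_{t₁−s₁}(y₁,w₁) · K_{t₂−s₂}(y₂,w₂) · K_{σ₁}(z₁,z₂) · K_{τ₁}(w₁,w₂) · K_{τ₂}(w₁,w₂) · K_{τ₃}(w₁,w₂) dw₁ dw₂ ≤ C · σ₁^{−3/2} · (τ₁·τ₂·τ₃)^{−5/4} · (t₂−s₂)^{−3/4}. -/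
open MeasureTheory Real

noncomputable section

/-- Mehler heat kernel of the harmonic oscillator `H = -Δ + |x|²` on `ℝ³`. -/
def mehlerK (t : ℝ) (x y : EuclideanSpace ℝ (Fin 3)) : ℝ :=
  (2 * π * Real.sinh (2 * t)) ^ (-(3 : ℝ) / 2) *
    Real.exp (-‖x - y‖ ^ 2 / (4 * Real.tanh t) - Real.tanh t * ‖x + y‖ ^ 2 / 4)

/-- The Euclidean heat kernel on `ℝ³`. -/
def heatK (t : ℝ) (x y : EuclideanSpace ℝ (Fin 3)) : ℝ :=
  (4 * π * t) ^ (-(3 : ℝ) / 2) * Real.exp (-(1 / (4 * t)) * ‖x - y‖ ^ 2)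

theorem tanh_le_self {t : ℝ} (ht : 0 ≤ t) : Real.tanh t ≤ t := by
  have hder : ∀ x : ℝ, HasDerivAt (fun x => x * Real.cosh x - Real.sinh x)
      (x * Real.sinh x) x := by
    intro x
    have h := ((hasDerivAt_id x).mul (Real.hasDerivAt_cosh x)).sub (Real.hasDerivAt_sinh x)
    convert! h using 1
    simp
  have hmono : MonotoneOn (fun x => x * Real.cosh x - Real.sinh x) (Set.Ici (0 : ℝ)) := by
    apply monotoneOn_of_deriv_nonneg (convex_Ici 0)
    · exact fun x _ => (hder x).continuousAt.continuousWithinAt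
    · exact fun x _ => (hder x).differentiableAt.differentiableWithinAt
    · intro x hx
      rw [(hder x).deriv]
      have hx0 : 0 ≤ x := interior_subset hx
      exact mul_nonneg hx0 (Real.sinh_nonneg_iff.2 hx0)
  have h := hmono (Set.mem_Ici.2 le_rfl) (Set.mem_Ici.2 ht) ht
  simp only [zero_mul, Real.sinh_zero, sub_zero, sub_nonneg] at h
  rw [Real.tanh_eq_sinh_div_cosh, div_le_iff₀ (Real.cosh_pos t)]
  exact h

theorem mehlerK_nonneg {t : ℝ} (ht : 0 < t) (x y : EuclideanSpace ℝ (Fin 3)) :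
    0 ≤ mehlerK t x y := by
  have : 0 < Real.sinh (2 * t) := Real.sinh_pos_iff.2 (by linarith)
  unfold mehlerK
  positivity

theorem heatK_nonneg {t : ℝ} (ht : 0 < t) (x y : EuclideanSpace ℝ (Fin 3)) :
    0 ≤ heatK t x y := by
  unfold heatK
  positivity

theorem mehlerK_le_heatK {t : ℝ} (ht : 0 < t) (x y : EuclideanSpace ℝ (Fin 3)) :
    mehlerK t x y ≤ heatK t x y := by
  have hsinh : 2 * t ≤ Real.sinh (2 * t) := Real.self_le_sinh_iff.2 (by linarith)
  have htanh : 0 < Real.tanh t := by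
    rw [Real.tanh_eq_sinh_div_cosh]
    exact div_pos (Real.sinh_pos_iff.2 ht) (Real.cosh_pos t)
  unfold mehlerK heatK
  refine mul_le_mul ?_ ?_ (Real.exp_pos _).le (by positivity)
  · refine Real.rpow_le_rpow_of_nonpos (by positivity) ?_ (by norm_num)
    nlinarith [Real.pi_pos]
  · apply Real.exp_le_exp.2
    have h₁ : 1 / (4 * t) * ‖x - y‖ ^ 2 ≤ 1 / (4 * Real.tanh t) * ‖x - y‖ ^ 2 := by
      gcongr
      exact tanh_le_self ht.le
    have h₂ : 0 ≤ Real.tanh t * ‖x + y‖ ^ 2 / 4 := by positivity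
    have h₃ : -‖x - y‖ ^ 2 / (4 * Real.tanh t) =
        -(1 / (4 * Real.tanh t) * ‖x - y‖ ^ 2) := by ring
    rw [h₃]
    linarith

theorem heatK_le {t : ℝ} (ht : 0 < t) (x y : EuclideanSpace ℝ (Fin 3)) :
    heatK t x y ≤ t ^ (-(3 : ℝ) / 2) * Real.exp (-(1 / (4 * t)) * ‖x - y‖ ^ 2) := by
  unfold heatK
  gcongr ?_ * _
  refine Real.rpow_le_rpow_of_nonpos ht ?_ (by norm_num)
  nlinarith [Real.pi_gt_three]

theorem mehlerK_le_rpow_mul_exp {t : ℝ} (ht : 0 < t) (x y : EuclideanSpace ℝ (Fin 3)) :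
    mehlerK t x y ≤ t ^ (-(3 : ℝ) / 2) * Real.exp (-(1 / (4 * t)) * ‖x - y‖ ^ 2) :=
  (mehlerK_le_heatK ht x y).trans (heatK_le ht x y)

theorem mehlerK_le_rpow {t : ℝ} (ht : 0 < t) (x y : EuclideanSpace ℝ (Fin 3)) :
    mehlerK t x y ≤ t ^ (-(3 : ℝ) / 2) := by
  refine (mehlerK_le_rpow_mul_exp ht x y).trans (mul_le_of_le_one_right (by positivity) ?_)
  apply Real.exp_le_one_iff.2
  have : 0 ≤ 1 / (4 * t) * ‖x - y‖ ^ 2 := by positivity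
  linarith

theorem integral_exp_neg_mul_norm_sub_sq {b : ℝ} (hb : 0 < b) (x : EuclideanSpace ℝ (Fin 3)) :
    ∫ y, Real.exp (-b * ‖x - y‖ ^ 2) = (π / b) ^ ((3 : ℝ) / 2) := by
  rw [integral_sub_left_eq_self (fun v : EuclideanSpace ℝ (Fin 3) => Real.exp (-b * ‖v‖ ^ 2))
    volume x, GaussianFourier.integral_rexp_neg_mul_sq_norm hb]
  simp

theorem integrable_exp_neg_mul_norm_sub_sq {b : ℝ} (hb : 0 < b)
    (x : EuclideanSpace ℝ (Fin 3)) :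
    Integrable (fun y => Real.exp (-b * ‖x - y‖ ^ 2)) := by
  apply Integrable.of_integral_ne_zero
  rw [integral_exp_neg_mul_norm_sub_sq hb]
  positivity

theorem integrable_heatK {t : ℝ} (ht : 0 < t) (x : EuclideanSpace ℝ (Fin 3)) :
    Integrable (heatK t x) :=
  (integrable_exp_neg_mul_norm_sub_sq (by positivity) x).const_mul _

theorem integral_heatK {t : ℝ} (ht : 0 < t) (x : EuclideanSpace ℝ (Fin 3)) :
    ∫ y, heatK t x y = 1 := by
  unfold heatK
  rw [integral_const_mul, integral_exp_neg_mul_norm_sub_sq (by positivity),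
    show π / (1 / (4 * t)) = 4 * π * t by field_simp,
    ← Real.rpow_add (by positivity)]
  norm_num

theorem integrable_heatK_mul_exp {b s : ℝ} (hb : 0 < b) (hs : 0 < s)
    (x y : EuclideanSpace ℝ (Fin 3)) :
    Integrable (fun w => heatK b y w * Real.exp (-(s / 4) * ‖x - w‖ ^ 2)) := by
  refine (integrable_heatK hb y).mul_bdd (c := 1) ?_ ?_
  · exact (integrable_exp_neg_mul_norm_sub_sq (by positivity) x).aestronglyMeasurable
  · refine Filter.Eventually.of_forall fun w => ?_
    rw [Real.norm_eq_abs, Real.abs_exp]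
    apply Real.exp_le_one_iff.2
    have : 0 ≤ s / 4 * ‖x - w‖ ^ 2 := by positivity
    linarith

theorem integral_heatK_mul_exp_le {b s : ℝ} (hb : 0 < b) (hs : 0 < s)
    (x y : EuclideanSpace ℝ (Fin 3)) :
    ∫ w, heatK b y w * Real.exp (-(s / 4) * ‖x - w‖ ^ 2) ≤ (b * s) ^ (-(3 : ℝ) / 4) := by
  have hexp : ∀ c : ℝ, 0 ≤ c → ∀ v : EuclideanSpace ℝ (Fin 3),
      Real.exp (-c * ‖v‖ ^ 2) ≤ 1 := by
    intro c hc v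
    apply Real.exp_le_one_iff.2
    have : 0 ≤ c * ‖v‖ ^ 2 := by positivity
    linarith
  rcases le_total (b * s) 1 with h | h
  · calc ∫ w, heatK b y w * Real.exp (-(s / 4) * ‖x - w‖ ^ 2) ≤ ∫ w, heatK b y w :=
          integral_mono (integrable_heatK_mul_exp hb hs x y) (integrable_heatK hb y)
            fun w => mul_le_of_le_one_right (heatK_nonneg hb y w) (hexp _ (by positivity) _)
      _ = 1 := integral_heatK hb y
      _ ≤ (b * s) ^ (-(3 : ℝ) / 4) :=
          Real.one_le_rpow_of_pos_of_le_one_of_nonpos (by positivity) h (by norm_num)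
  · calc ∫ w, heatK b y w * Real.exp (-(s / 4) * ‖x - w‖ ^ 2)
        ≤ ∫ w, (4 * π * b) ^ (-(3 : ℝ) / 2) * Real.exp (-(s / 4) * ‖x - w‖ ^ 2) := by
          refine integral_mono (integrable_heatK_mul_exp hb hs x y)
            ((integrable_exp_neg_mul_norm_sub_sq (by positivity) x).const_mul _) fun w => ?_
          refine mul_le_mul_of_nonneg_right ?_ (Real.exp_pos _).le
          exact mul_le_of_le_one_right (by positivity) (hexp _ (by positivity) _)
      _ = (b * s) ^ (-(3 : ℝ) / 2) := by
          rw [integral_const_mul, integral_exp_neg_mul_norm_sub_sq (by positivity),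
            show π / (s / 4) = (s / (4 * π))⁻¹ by field_simp,
            Real.inv_rpow (by positivity), ← Real.rpow_neg (by positivity), ← neg_div,
            ← Real.mul_rpow (by positivity) (by positivity)]
          congr 1
          field_simp
      _ ≤ (b * s) ^ (-(3 : ℝ) / 4) := Real.rpow_le_rpow_of_exponent_le h (by norm_num)

theorem inv_add_inv_add_inv_rpow_le {a b c : ℝ} (ha : 0 < a) (hb : 0 < b) (hc : 0 < c) :
    (1 / a + 1 / b + 1 / c) ^ (-(3 : ℝ) / 4) ≤ (a * b * c) ^ ((1 : ℝ) / 4) := by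
  have hcube : (a * b * c)⁻¹ ≤ (1 / a + 1 / b + 1 / c) ^ 3 := by
    have ha' : 0 < 1 / a := by positivity
    have hb' : 0 < 1 / b := by positivity
    have hc' : 0 < 1 / c := by positivity
    calc (a * b * c)⁻¹ = 1 / a * (1 / b) * (1 / c) := by field_simp
      _ ≤ (1 / a + 1 / b + 1 / c) * (1 / a + 1 / b + 1 / c) * (1 / a + 1 / b + 1 / c) := by
          gcongr <;> linarith
      _ = _ := by ring
  calc (1 / a + 1 / b + 1 / c) ^ (-(3 : ℝ) / 4)
      = ((1 / a + 1 / b + 1 / c) ^ 3) ^ (-(1 : ℝ) / 4) := by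
        rw [← Real.rpow_natCast, ← Real.rpow_mul (by positivity)]
        norm_num
    _ ≤ ((a * b * c)⁻¹) ^ (-(1 : ℝ) / 4) :=
        Real.rpow_le_rpow_of_nonpos (by positivity) hcube (by norm_num)
    _ = (a * b * c) ^ ((1 : ℝ) / 4) := by
        rw [Real.inv_rpow (by positivity), ← Real.rpow_neg (by positivity)]
        norm_num

theorem mehlerK_prod_three_le {a b c : ℝ} (ha : 0 < a) (hb : 0 < b) (hc : 0 < c)
    (x y : EuclideanSpace ℝ (Fin 3)) :
    mehlerK a x y * mehlerK b x y * mehlerK c x y ≤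
      (a * b * c) ^ (-(3 : ℝ) / 2) *
        Real.exp (-((1 / a + 1 / b + 1 / c) / 4) * ‖x - y‖ ^ 2) := by
  have hKa := mehlerK_nonneg ha x y
  have hKb := mehlerK_nonneg hb x y
  have hKc := mehlerK_nonneg hc x y
  have hexp : Real.exp (-((1 / a + 1 / b + 1 / c) / 4) * ‖x - y‖ ^ 2) =
      Real.exp (-(1 / (4 * a)) * ‖x - y‖ ^ 2) * Real.exp (-(1 / (4 * b)) * ‖x - y‖ ^ 2) *
        Real.exp (-(1 / (4 * c)) * ‖x - y‖ ^ 2) := by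
    rw [← Real.exp_add, ← Real.exp_add]
    congr 1
    field_simp
    ring
  calc mehlerK a x y * mehlerK b x y * mehlerK c x y
      ≤ (a ^ (-(3 : ℝ) / 2) * Real.exp (-(1 / (4 * a)) * ‖x - y‖ ^ 2)) *
        (b ^ (-(3 : ℝ) / 2) * Real.exp (-(1 / (4 * b)) * ‖x - y‖ ^ 2)) *
        (c ^ (-(3 : ℝ) / 2) * Real.exp (-(1 / (4 * c)) * ‖x - y‖ ^ 2)) := by
        gcongr <;> exact mehlerK_le_rpow_mul_exp (by assumption) x y
    _ = _ := by
        rw [hexp, Real.mul_rpow (by positivity) (by positivity),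
          Real.mul_rpow (by positivity) (by positivity)]
        ring

/-- a product-of-kernels integral bound (estimate on `ℱ^{1,1}`). -/
theorem kernel_product_bound_F11 (T : ℝ) (hT : 0 < T) :
    ∃ C : ℝ, 0 < C ∧
      ∀ t₁ t₂ s₁ s₂ σ₁ τ₁ τ₂ τ₃ : ℝ,
        0 < s₁ → s₁ < t₁ → t₁ ≤ T → 0 < s₂ → s₂ < t₂ → t₂ ≤ T →
        0 < σ₁ → σ₁ ≤ 2 * T + 2 → 0 < τ₁ → τ₁ ≤ 2 * T + 2 →
        0 < τ₂ → τ₂ ≤ 2 * T + 2 → 0 < τ₃ → τ₃ ≤ 2 * T + 2 →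
        ∀ y₁ y₂ z₁ z₂ : EuclideanSpace ℝ (Fin 3),
          (∫ w₁, ∫ w₂,
              mehlerK (t₁ - s₁) y₁ w₁ * mehlerK (t₂ - s₂) y₂ w₂ * mehlerK σ₁ z₁ z₂ *
                mehlerK τ₁ w₁ w₂ * mehlerK τ₂ w₁ w₂ * mehlerK τ₃ w₁ w₂) ≤
            C * σ₁ ^ (-(3 : ℝ) / 2) * (τ₁ * τ₂ * τ₃) ^ (-(5 : ℝ) / 4) *
              (t₂ - s₂) ^ (-(3 : ℝ) / 4) := by
  refine ⟨1, one_pos, ?_⟩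
  intro t₁ t₂ s₁ s₂ σ₁ τ₁ τ₂ τ₃ _ hst₁ _ _ hst₂ _ hσ _ hτ₁ _ hτ₂ _ hτ₃ _ y₁ y₂ z₁ z₂
  have ha : 0 < t₁ - s₁ := sub_pos.2 hst₁
  have hb : 0 < t₂ - s₂ := sub_pos.2 hst₂
  generalize t₁ - s₁ = a at ha ⊢
  generalize t₂ - s₂ = b at hb ⊢
  set S : ℝ := 1 / τ₁ + 1 / τ₂ + 1 / τ₃ with hS_def
  have hS : 0 < S := by positivity
  set M : ℝ := 1 * σ₁ ^ (-(3 : ℝ) / 2) * (τ₁ * τ₂ * τ₃) ^ (-(5 : ℝ) / 4) *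
    b ^ (-(3 : ℝ) / 4) with hM
  have hnonneg : ∀ w₁ w₂, 0 ≤ mehlerK a y₁ w₁ * mehlerK b y₂ w₂ * mehlerK σ₁ z₁ z₂ *
      mehlerK τ₁ w₁ w₂ * mehlerK τ₂ w₁ w₂ * mehlerK τ₃ w₁ w₂ := by
    intro w₁ w₂
    have h₁ := mehlerK_nonneg ha y₁ w₁
    have h₂ := mehlerK_nonneg hb y₂ w₂
    have h₃ := mehlerK_nonneg hσ z₁ z₂
    have h₄ := mehlerK_nonneg hτ₁ w₁ w₂
    have h₅ := mehlerK_nonneg hτ₂ w₁ w₂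
    have h₆ := mehlerK_nonneg hτ₃ w₁ w₂
    positivity
  have hpoint : ∀ w₁ w₂, mehlerK a y₁ w₁ * mehlerK b y₂ w₂ * mehlerK σ₁ z₁ z₂ *
      mehlerK τ₁ w₁ w₂ * mehlerK τ₂ w₁ w₂ * mehlerK τ₃ w₁ w₂ ≤
      heatK a y₁ w₁ * σ₁ ^ (-(3 : ℝ) / 2) * (τ₁ * τ₂ * τ₃) ^ (-(3 : ℝ) / 2) *
        (heatK b y₂ w₂ * Real.exp (-(S / 4) * ‖w₁ - w₂‖ ^ 2)) := by
    intro w₁ w₂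
    have h₁ := mehlerK_nonneg ha y₁ w₁
    have h₂ := mehlerK_nonneg hb y₂ w₂
    have h₃ := mehlerK_nonneg hσ z₁ z₂
    have h₄ := mehlerK_nonneg hτ₁ w₁ w₂
    have h₅ := mehlerK_nonneg hτ₂ w₁ w₂
    have h₆ := mehlerK_nonneg hτ₃ w₁ w₂
    have h₇ := heatK_nonneg ha y₁ w₁
    have h₈ := heatK_nonneg hb y₂ w₂
    calc _ = mehlerK a y₁ w₁ * mehlerK b y₂ w₂ * mehlerK σ₁ z₁ z₂ *
          (mehlerK τ₁ w₁ w₂ * mehlerK τ₂ w₁ w₂ * mehlerK τ₃ w₁ w₂) := by ring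
      _ ≤ heatK a y₁ w₁ * heatK b y₂ w₂ * σ₁ ^ (-(3 : ℝ) / 2) *
          ((τ₁ * τ₂ * τ₃) ^ (-(3 : ℝ) / 2) * Real.exp (-(S / 4) * ‖w₁ - w₂‖ ^ 2)) :=
          mul_le_mul (mul_le_mul (mul_le_mul (mehlerK_le_heatK ha y₁ w₁)
            (mehlerK_le_heatK hb y₂ w₂) h₂ h₇) (mehlerK_le_rpow hσ z₁ z₂) h₃ (by positivity))
            (mehlerK_prod_three_le hτ₁ hτ₂ hτ₃ w₁ w₂) (by positivity) (by positivity)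
      _ = _ := by ring
  have hconst : σ₁ ^ (-(3 : ℝ) / 2) * (τ₁ * τ₂ * τ₃) ^ (-(3 : ℝ) / 2) *
      (b * S) ^ (-(3 : ℝ) / 4) ≤ M := by
    calc _ = σ₁ ^ (-(3 : ℝ) / 2) * (τ₁ * τ₂ * τ₃) ^ (-(3 : ℝ) / 2) *
          (b ^ (-(3 : ℝ) / 4) * S ^ (-(3 : ℝ) / 4)) := by
          rw [Real.mul_rpow hb.le hS.le]
      _ ≤ σ₁ ^ (-(3 : ℝ) / 2) * (τ₁ * τ₂ * τ₃) ^ (-(3 : ℝ) / 2) *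
          (b ^ (-(3 : ℝ) / 4) * (τ₁ * τ₂ * τ₃) ^ ((1 : ℝ) / 4)) := by
          gcongr
          exact inv_add_inv_add_inv_rpow_le hτ₁ hτ₂ hτ₃
      _ = M := by
          rw [hM, show -(5 : ℝ) / 4 = -(3 : ℝ) / 2 + 1 / 4 by norm_num,
            Real.rpow_add (by positivity)]
          ring
  have hinner : ∀ w₁, (∫ w₂, mehlerK a y₁ w₁ * mehlerK b y₂ w₂ * mehlerK σ₁ z₁ z₂ *
      mehlerK τ₁ w₁ w₂ * mehlerK τ₂ w₁ w₂ * mehlerK τ₃ w₁ w₂) ≤ heatK a y₁ w₁ * M := by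
    intro w₁
    have h₇ := heatK_nonneg ha y₁ w₁
    calc _ ≤ ∫ w₂, heatK a y₁ w₁ * σ₁ ^ (-(3 : ℝ) / 2) * (τ₁ * τ₂ * τ₃) ^ (-(3 : ℝ) / 2) *
          (heatK b y₂ w₂ * Real.exp (-(S / 4) * ‖w₁ - w₂‖ ^ 2)) :=
          integral_mono_of_nonneg (Filter.Eventually.of_forall (hnonneg w₁))
            ((integrable_heatK_mul_exp hb hS w₁ y₂).const_mul _)
            (Filter.Eventually.of_forall (hpoint w₁))
      _ ≤ heatK a y₁ w₁ * σ₁ ^ (-(3 : ℝ) / 2) * (τ₁ * τ₂ * τ₃) ^ (-(3 : ℝ) / 2) *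
          (b * S) ^ (-(3 : ℝ) / 4) := by
          rw [integral_const_mul]
          gcongr
          exact integral_heatK_mul_exp_le hb hS w₁ y₂
      _ = heatK a y₁ w₁ * (σ₁ ^ (-(3 : ℝ) / 2) * (τ₁ * τ₂ * τ₃) ^ (-(3 : ℝ) / 2) *
          (b * S) ^ (-(3 : ℝ) / 4)) := by ring
      _ ≤ heatK a y₁ w₁ * M := by gcongr
  calc _ ≤ ∫ w₁, heatK a y₁ w₁ * M :=
        integral_mono_of_nonneg
          (Filter.Eventually.of_forall fun w₁ => integral_nonneg (hnonneg w₁))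
          ((integrable_heatK ha y₁).mul_const M) (Filter.Eventually.of_forall hinner)
    _ = M := by rw [integral_mul_const, integral_heatK ha, one_mul]

end
end
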